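/- Let φ_c(z) = z² + c with c ∈ ℚ, N odd, K/ℚ a quadratic extension, and (z_0,...,z_{N-1}) an exact N-cycle of φ_c in K. Suppose some nontrivial element τ ∈ Gal(K/ℚ) maps some z_j to some z_k (i.e., case (ii) of the Galois dichotomy fails). Then all z_j are rational. -/

import Mathlib

/-- For N odd and K/ℚ quadratic, if the nontrivial automorphism τ maps some
element of an exact N-cycle of φ_c(z) = z² + c into the cycle, then the whole
cycle is rational. -/
theorem odd_cycle_rational (N : ℕ) (hN : 0 < N) (hodd : Odd N)
    (K : Type*) [Field K] [Algebra ℚ K] [FiniteDimensional ℚ K]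
    (hquad : Module.finrank ℚ K = 2)
    (c : ℚ) (z : ZMod N → K)
    (hcyc : ∀ j : ZMod N, (z j) ^ 2 + algebraMap ℚ K c = z (j + 1))
    (hinj : Function.Injective z)
    (τ : K ≃ₐ[ℚ] K) (hτ : τ ≠ 1)
    (j k : ZMod N) (h : τ (z j) = z k) :
    ∀ i : ZMod N, ∃ q : ℚ, algebraMap ℚ K q = z i := by
  haveI : NeZero N := ⟨hN.ne'⟩
  have hstep : ∀ n : ℕ, τ (z (j + n)) = z (k + n) := by
    intro n
    induction n with
    | zero => simpa using h
    | succ n ih =>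
      have e1 : (j + ((n + 1 : ℕ) : ZMod N)) = (j + n) + 1 := by push_cast; ring
      have e2 : (k + ((n + 1 : ℕ) : ZMod N)) = (k + n) + 1 := by push_cast; ring
      rw [e1, e2, ← hcyc, ← hcyc, map_add, map_pow, ih, AlgEquiv.commutes]
  have hall : ∀ i, τ (z i) = z (i + (k - j)) := by
    intro i
    have h1 := hstep (i - j).val
    rw [ZMod.natCast_zmod_val] at h1
    convert h1 using 2
    · congr 1; ring
    · ring
  have hsq : τ ^ 2 = 1 := by
    have hle : Nat.card (K ≃ₐ[ℚ] K) ≤ 2 := by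
      rw [Nat.card_eq_fintype_card, ← hquad]
      exact AlgEquiv.card_le
    have hpos : 0 < Nat.card (K ≃ₐ[ℚ] K) := Nat.card_pos
    have hpow : τ ^ Nat.card (K ≃ₐ[ℚ] K) = 1 := pow_card_eq_one'
    have hcases : Nat.card (K ≃ₐ[ℚ] K) = 1 ∨ Nat.card (K ≃ₐ[ℚ] K) = 2 := by omega
    rcases hcases with h1 | h2
    · rw [h1, pow_one] at hpow
      exact absurd hpow hτ
    · rwa [h2] at hpow
  have hd : k - j = 0 := by
    have h1 : τ (τ (z j)) = z j := by
      have := congrArg (fun σ : K ≃ₐ[ℚ] K => σ (z j)) hsq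
      simpa [pow_two] using this
    rw [hall, hall] at h1
    have h2 := hinj h1
    have h3 : ((2 : ℕ) : ZMod N) * (k - j) = 0 := by
      push_cast
      linear_combination h2
    have hu : IsUnit ((2 : ℕ) : ZMod N) :=
      (ZMod.isUnit_iff_coprime 2 N).2 (Nat.coprime_two_left.2 hodd)
    exact hu.mul_right_eq_zero.1 h3
  intro i
  have hfix : τ (z i) = z i := by rw [hall, hd, add_zero]
  haveI : IsSimpleOrder (Subalgebra ℚ K) :=
    Subalgebra.isSimpleOrder_of_finrank_prime ℚ K (hquad ▸ Nat.prime_two)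
  have hmem : z i ∈ AlgHom.equalizer (τ : K →ₐ[ℚ] K) (AlgHom.id ℚ K) := hfix
  rcases eq_bot_or_eq_top (AlgHom.equalizer (τ : K →ₐ[ℚ] K) (AlgHom.id ℚ K)) with hb | ht
  · rw [hb] at hmem
    exact Algebra.mem_bot.1 hmem
  · refine absurd (AlgEquiv.ext fun x => ?_) hτ
    have hx : x ∈ AlgHom.equalizer (τ : K →ₐ[ℚ] K) (AlgHom.id ℚ K) := by
      rw [ht]; exact Algebra.mem_top
    exact hx
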